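/- Let Φ : ℝ → ℝ be differentiable and let a ≠ b be real numbers with J(a,b) = 0 and σ(a,b) > 0. Then for every real v_L and every sign ε ∈ {+1, −1}, setting c = ε·√(σ(a,b)) and v_R = v_L + c(a − b), the states (r_L, v_L) = (a, v_L) and (r_R, v_R) = (b, v_R) with speed c satisfy all three jump conditions for mass, momentum and energy: c(r_L − r_R) + (v_L − v_R) = 0, c(v_L − v_R) + (Φ'(r_L) − Φ'(r_R)) = 0, and c(½v_L² + Φ(r_L) − ½v_R² − Φ(r_R)) + (v_L Φ'(r_L) − v_R Φ'(r_R)) = 0. In particular each solution of J = 0 with positive secant slope gives rise to both a conservative 1-shock (c < 0) and a conservative 2-shock (c > 0). -/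

import Mathlib

/-- Conservative-shock function `J(a,b) = Φ(a) − Φ(b) − ((a−b)/2)·(Φ'(a) + Φ'(b))`. -/
noncomputable def consJ (Φ : ℝ → ℝ) (a b : ℝ) : ℝ :=
  Φ a - Φ b - ((a - b) / 2) * (deriv Φ a + deriv Φ b)

/-- Rankine–Hugoniot (secant) slope `σ(a,b) = (Φ'(a) − Φ'(b))/(a − b)`. -/
noncomputable def rhSlope (Φ : ℝ → ℝ) (a b : ℝ) : ℝ :=
  (deriv Φ a - deriv Φ b) / (a - b)

theorem stmt1 (Φ : ℝ → ℝ) (hΦ : Differentiable ℝ Φ) (a b : ℝ) (hab : a ≠ b)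
    (hJ : consJ Φ a b = 0) (hσ : 0 < rhSlope Φ a b) :
    ∀ vL ε : ℝ, (ε = 1 ∨ ε = -1) →
      ∀ c vR : ℝ,
        c = ε * Real.sqrt (rhSlope Φ a b) →
        vR = vL + c * (a - b) →
        c * (a - b) + (vL - vR) = 0 ∧
        c * (vL - vR) + (deriv Φ a - deriv Φ b) = 0 ∧
        c * ((1 / 2) * vL ^ 2 + Φ a - (1 / 2) * vR ^ 2 - Φ b)
          + (vL * deriv Φ a - vR * deriv Φ b) = 0 := by
  intro vL ε hε c vR hc hvR
  have hc2 : c ^ 2 * (a - b) = deriv Φ a - deriv Φ b := by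
    have hε2 : ε ^ 2 = 1 := by rcases hε with rfl | rfl <;> norm_num
    rw [hc, mul_pow, hε2, Real.sq_sqrt hσ.le, one_mul, rhSlope,
      div_mul_cancel₀ _ (sub_ne_zero.mpr hab)]
  unfold consJ at hJ
  subst hvR
  refine ⟨by ring, by linear_combination -hc2, ?_⟩
  linear_combination c * hJ - (vL + c * (a - b) / 2) * hc2
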